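/- Let ξ₁ ∈ Z₁ and ξ₂ ∈ Z₂, and let X be the set of one-dimensional F-subspaces ⟨v⟩ of F⁴ such that H(v) = 2ξ₁·Q(v)^{(q+1)/2} or H(v) = 2ξ₂·Q(v)^{(q+1)/2}. Then X has exactly (q²+1)(q³+1) elements, and for every nonzero F-linear functional π on F⁴, the number of ⟨v⟩ ∈ X with π(v) = 0 is either q³+1 or q³+q²+1. (The join S_{ξ₁} ∪ S_{ξ₂} is a quasi-Hermitian surface of PG(3,q²): it has the same size and the same plane-intersection numbers as a nondegenerate Hermitian surface.) -/

import Mathlib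

/-- `Q(α,β,γ,δ) = αδ - βγ`, the quadratic form of the hyperbolic quadric. -/
def Qf {F : Type*} [Field F] (v : Fin 4 → F) : F := v 0 * v 3 - v 1 * v 2

/-- `H(α,β,γ,δ) = α^{q+1} - β^{q+1} - γ^{q+1} + δ^{q+1}`, the Hermitian form. -/
def Hf (q : ℕ) {F : Type*} [Field F] (v : Fin 4 → F) : F :=
  v 0 ^ (q + 1) - v 1 ^ (q + 1) - v 2 ^ (q + 1) + v 3 ^ (q + 1)

/-- `v = (α,β,γ,δ)` is nonsingular if `(αz + δ^q z^q)x + (γz + β^q z^q)x^q ≠ 0`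
for all nonzero `x, z`. -/
def Nonsingular (q : ℕ) {F : Type*} [Field F] (v : Fin 4 → F) : Prop :=
  ∀ x z : F, x ≠ 0 → z ≠ 0 →
    (v 0 * z + v 3 ^ q * z ^ q) * x + (v 2 * z + v 1 ^ q * z ^ q) * x ^ q ≠ 0

/-- `Δ(v) = H(v)² - 4·Q(v)^{q+1}`. -/
def Deltaf (q : ℕ) {F : Type*} [Field F] (v : Fin 4 → F) : F :=
  Hf q v ^ 2 - 4 * Qf v ^ (q + 1)

/-- A Σ-vector: a nonzero vector of the form `(α, β, β^q, α^q)`. -/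
def IsSigmaVec (q : ℕ) {F : Type*} [Field F] (v : Fin 4 → F) : Prop :=
  v ≠ 0 ∧ ∃ α β : F, v = ![α, β, β ^ q, α ^ q]

/-- The sesquilinear form `h(u,v) = u₁v₁^q - u₂v₂^q - u₃v₃^q + u₄v₄^q`. -/
def hForm (q : ℕ) {F : Type*} [Field F] (u v : Fin 4 → F) : F :=
  u 0 * v 0 ^ q - u 1 * v 1 ^ q - u 2 * v 2 ^ q + u 3 * v 3 ^ q

/-- The one-dimensional `F`-subspace (as a set) spanned by `v`. -/
def Fline {F : Type*} [Field F] (v : Fin 4 → F) : Set (Fin 4 → F) :=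
  {x | ∃ a : F, x = a • v}

/-- The number of one-dimensional `𝔽_q`-subspaces `⟨(s,t)⟩` of `𝔽_q²` with
`Q(s·u + t·w) = 0`. -/
noncomputable def tangentCount (q : ℕ) {F : Type*} [Field F] (u w : Fin 4 → F) : ℕ :=
  Set.ncard {L : Set (F × F) | ∃ s t : F, s ^ q = s ∧ t ^ q = t ∧ (s, t) ≠ (0, 0) ∧
    Qf (fun i => s * u i + t * w i) = 0 ∧
    L = {p : F × F | ∃ e : F, e ^ q = e ∧ p = (e * s, e * t)}}

/-- `Z₁`: the set of `ξ ∉ {0, 1, -1}` such that `1 - ξ⁻²` is a nonzero square of `𝔽_q`. -/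
def Zone (q : ℕ) (F : Type*) [Field F] : Set F :=
  {ξ | ξ ≠ 0 ∧ ξ ≠ 1 ∧ ξ ≠ -1 ∧ ∃ s : F, s ^ q = s ∧ s ≠ 0 ∧ 1 - (ξ ^ 2)⁻¹ = s ^ 2}

/-- `Z₂`: the set of `ξ ≠ 0` such that `1 - ξ⁻²` is a nonzero nonsquare of `𝔽_q`. -/
def Ztwo (q : ℕ) (F : Type*) [Field F] : Set F :=
  {ξ | ξ ≠ 0 ∧ (1 - (ξ ^ 2)⁻¹) ^ q = 1 - (ξ ^ 2)⁻¹ ∧ 1 - (ξ ^ 2)⁻¹ ≠ 0 ∧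
    ¬∃ s : F, s ^ q = s ∧ 1 - (ξ ^ 2)⁻¹ = s ^ 2}

/-- The join of the point sets of `S_{ξ₁}` and `S_{ξ₂}`, for `ξ₁ ∈ Z₁` and `ξ₂ ∈ Z₂`. -/
def joinSet (q : ℕ) {F : Type*} [Field F] (ξ₁ ξ₂ : F) : Set (Set (Fin 4 → F)) :=
  {L | ∃ v : Fin 4 → F, v ≠ 0 ∧
    (Hf q v = 2 * ξ₁ * Qf v ^ ((q + 1) / 2) ∨ Hf q v = 2 * ξ₂ * Qf v ^ ((q + 1) / 2)) ∧
    L = Fline v}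

open Finset in
/-- `σ` is the involution `x ↦ x ^ q` of the field `F` with `q ^ 2` elements, `q` odd, and `e` is
a primitive additive character of `F` invariant under `σ`. -/
structure IsConjSetting {F : Type*} [Field F] [Fintype F] (q : ℕ) (σ : F →+* F)
    (e : AddChar F ℂ) : Prop where
  card_eq : Fintype.card F = q ^ 2
  two_ne : (2 : F) ≠ 0
  one_lt : 1 < q
  odd : Odd q
  map_eq : ∀ x, σ x = x ^ q
  char_inv : ∀ x, e (σ x) = e x
  prim : e.IsPrimitive

/-- The Gauss sum of the binary form `Tr (β g² + κ g σ(g))`. -/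
noncomputable def binGauss {F : Type*} [Field F] [Fintype F] (σ : F →+* F)
    (e : AddChar F ℂ) (β κ : F) : ℂ :=
  ∑ g, e (β * g ^ 2 + κ * (g * σ g))

/-- The exponential sum over the part of the space where the two linear conditions hold. -/
noncomputable def planeSum {F : Type*} [Field F] [Fintype F] (σ : F →+* F) (e : AddChar F ℂ)
    (P P' R R' b κ : F) : ℂ :=
  open Classical in
  ∑ t, ∑ s : F × F, if b * s.1 + κ * σ s.2 + t * R = 0 ∧ b * s.2 + κ * σ s.1 + t * R' = 0 then
    e (t * (s.1 * P + s.2 * P')) else 0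

open Classical in
theorem exists_isConjSetting {q : ℕ} (hq : ∃ p k : ℕ, p.Prime ∧ 0 < k ∧ q = p ^ k)
    (hodd : Odd q) {F : Type*} [Field F] [Fintype F] (hF : Fintype.card F = q ^ 2) :
    ∃ (σ : F →+* F) (e : AddChar F ℂ), IsConjSetting q σ e := by
  obtain ⟨p, k, hp, hk, rfl⟩ := hq
  have : Fact p.Prime := ⟨hp⟩
  have : CharP F p := charP_of_card_eq_prime_pow (f := k * 2) (by rw [hF, ← pow_mul])
  have hp2 : p ≠ 2 := by
    rintro rfl
    rw [Nat.odd_pow_iff hk.ne'] at hodd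
    exact absurd hodd (by decide)
  have h2 : (2 : F) ≠ 0 := by
    have : ringChar F ≠ 2 := by rwa [ringChar.eq F p]
    exact Ring.two_ne_zero this
  have hinv : ∀ x : F, (x ^ p ^ k) ^ p ^ k = x := fun x => by
    rw [← pow_mul, ← pow_two, ← hF, FiniteField.pow_card]
  let σ : F →+* F := iterateFrobenius F p k
  have hσ : ∀ x, σ x = x ^ p ^ k := iterateFrobenius_def p k
  let ψ := AddChar.FiniteField.primitiveChar_to_Complex F
  have hψ : ψ.IsPrimitive := AddChar.FiniteField.primitiveChar_to_Complex_isPrimitive F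
  obtain ⟨y, hy⟩ := AddChar.ne_one_iff.1 (hψ one_ne_zero)
  rw [AddChar.mulShift_one] at hy
  let φ : F →+ F := (AddMonoidHom.mulLeft (y / 2)).comp (AddMonoidHom.id F + σ.toAddMonoidHom)
  have hφ : ∀ x, φ x = y / 2 * (x + σ x) := fun x => rfl
  refine ⟨σ, ψ.compAddMonoidHom φ, hF, h2, Nat.one_lt_pow hk.ne' hp.one_lt, hodd, hσ, ?_,
    AddChar.IsPrimitive.of_ne_one (AddChar.ne_one_iff.2 ⟨1, ?_⟩)⟩
  · intro x
    simp only [AddChar.compAddMonoidHom_apply, hφ]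
    rw [show σ (σ x) = x by rw [hσ, hσ, hinv], add_comm]
  · simp only [AddChar.compAddMonoidHom_apply, hφ, map_one]
    rwa [show y / 2 * (1 + 1) = y by field_simp; norm_num]

/-- Twisting data turning the equation `H = 2 ξ Q ^ ((q + 1) / 2)` into `Q = ω g²`,
`H = 2 ζ g σ(g)`. -/
structure IsTwist {F : Type*} [Field F] (q : ℕ) (σ : F →+* F) (ξ ω ζ : F) : Prop where
  omega_ne : ω ≠ 0
  zeta_ne : ζ ≠ 0
  conj_zeta : σ ζ = ζ
  zeta_eq : ζ = ξ * ω ^ ((q + 1) / 2)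

open Classical in
/-- The number of common zeros of the two binary forms left over by the Gauss sum evaluation. -/
noncomputable def twistCount {F : Type*} [Field F] [Fintype F] (σ : F →+* F) (ω ζ n a t : F) : ℕ :=
  Finset.card {w : F × F | 2 * ω * w.1 ^ 2 + n * σ a * σ w.2 ^ 2 = 0 ∧
    2 * (2 * ζ) * (w.1 * σ w.1) = n * t * (w.2 * σ w.2)}

/-- Coordinates in which both `2 Q` and `2 H` become hyperbolic. -/
def hypCoord {F : Type*} [Field F] (h2 : (2 : F) ≠ 0) : (F × F) × (F × F) ≃ (Fin 4 → F) where
  toFun u := ![(u.1.1 + u.2.2) / 2, (u.2.2 - u.1.1) / 2, (u.2.1 - u.1.2) / 2, (u.2.1 + u.1.2) / 2]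
  invFun v := ((v 0 - v 1, v 3 - v 2), (v 2 + v 3, v 0 + v 1))
  left_inv u := by
    obtain ⟨⟨p, p'⟩, r, r'⟩ := u
    simp only [Matrix.cons_val, Prod.mk.injEq]
    refine ⟨⟨?_, ?_⟩, ?_, ?_⟩ <;> field_simp <;> ring
  right_inv v := by
    ext i
    fin_cases i <;> simp <;> field_simp <;> ring

theorem two_mul_Qf_hypCoord {F : Type*} [Field F] (h2 : (2 : F) ≠ 0) (u : (F × F) × (F × F)) :
    2 * Qf (hypCoord h2 u) = u.1.1 * u.2.1 + u.1.2 * u.2.2 := by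
  simp only [Qf, hypCoord, Equiv.coe_fn_mk, Matrix.cons_val]
  field_simp
  ring

/-- The coefficients of a linear functional in the hyperbolic coordinates. -/
theorem exists_functional_coeff {F : Type*} [Field F] (h2 : (2 : F) ≠ 0)
    (π : (Fin 4 → F) →ₗ[F] F) : ∃ P P' R R' : F,
      (π = 0 ↔ P = 0 ∧ P' = 0 ∧ R = 0 ∧ R' = 0) ∧ ∀ u : (F × F) × (F × F),
        π (hypCoord h2 u) = u.1.1 * R + u.2.1 * P + u.1.2 * R' + u.2.2 * P' := by
  have hπ : ∀ v, π v = v 0 * π (Pi.single 0 1) + v 1 * π (Pi.single 1 1) +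
      v 2 * π (Pi.single 2 1) + v 3 * π (Pi.single 3 1) := fun v => by
    rw [LinearMap.pi_apply_eq_sum_univ π v, Fin.sum_univ_four]
    simp only [smul_eq_mul]
    congr! <;> simp [Pi.single_apply, eq_comm]
  have hu : ∀ u : (F × F) × (F × F), π (hypCoord h2 u) =
      u.1.1 * ((π (Pi.single 0 1) - π (Pi.single 1 1)) / 2) +
      u.2.1 * ((π (Pi.single 2 1) + π (Pi.single 3 1)) / 2) +
      u.1.2 * ((π (Pi.single 3 1) - π (Pi.single 2 1)) / 2) +
      u.2.2 * ((π (Pi.single 0 1) + π (Pi.single 1 1)) / 2) := fun u => by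
    rw [hπ]
    simp only [hypCoord, Equiv.coe_fn_mk, Matrix.cons_val]
    field_simp
    ring
  refine ⟨_, _, _, _, ⟨fun h0 => by simp [h0], ?_⟩, hu⟩
  rintro ⟨hP, hP', hR, hR'⟩
  ext1 i
  refine LinearMap.ext fun x => ?_
  obtain ⟨u, hu'⟩ := (hypCoord h2).surjective (Pi.single i x)
  have := hu u
  rw [hP, hP', hR, hR'] at this
  simpa [← hu'] using this

namespace IsConjSetting

variable {F : Type*} [Field F] [Fintype F] {q : ℕ} {σ : F →+* F} {e : AddChar F ℂ}

theorem zeros_iff {F : Type*} [Field F] {σ : F →+* F} {β κ s g : F} (hβ : β ≠ 0)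
    (hs : κ ^ 2 - β * σ β = s ^ 2) :
    β * g ^ 2 + σ β * σ g ^ 2 + 2 * κ * (g * σ g) = 0 ↔
      g = (-κ + s) / β * σ g ∨ g = (-κ - s) / β * σ g := by
  have h1 : ∀ x, g = x / β * σ g ↔ β * g - x * σ g = 0 := fun x => by
    rw [sub_eq_zero, div_mul_eq_mul_div, eq_div_iff hβ, mul_comm]
  rw [h1, h1, ← mul_eq_zero, ← mul_right_inj' hβ, mul_zero]
  rw [show (β * g - (-κ + s) * σ g) * (β * g - (-κ - s) * σ g) =
    β * (β * g ^ 2 + σ β * σ g ^ 2 + 2 * κ * (g * σ g)) by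
      linear_combination (σ g) ^ 2 * hs]

theorem invol (h : IsConjSetting q σ e) (x : F) : σ (σ x) = x := by
  rw [h.map_eq, h.map_eq, ← pow_mul, ← pow_two, ← h.card_eq, FiniteField.pow_card]

theorem mul_conj (h : IsConjSetting q σ e) (x : F) : x * σ x = x ^ (q + 1) := by
  rw [h.map_eq, pow_succ']

open Classical in
theorem sum_char (h : IsConjSetting q σ e) (x : F) :
    ∑ c, e (c * x) = if x = 0 then (q : ℂ) ^ 2 else 0 := by
  rw [AddChar.sum_mulShift x h.prim, h.card_eq]
  push_cast
  rfl

theorem char_congr (h : IsConjSetting q σ e) {x y : F} (hxy : x + σ x = y + σ y) :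
    e x = e y := by
  have key : ∀ z, e z = e ((z + σ z) / 2) := fun z => by
    have : NeZero (2 : F) := ⟨h.two_ne⟩
    have : e z = e (z / 2) * e (σ (z / 2)) := by
      rw [h.char_inv, ← AddChar.map_add_eq_mul, add_halves]
    rw [this, ← AddChar.map_add_eq_mul, map_div₀, map_ofNat, ← add_div]
  rw [key x, key y, hxy]

open Finset Classical in
theorem card_filter_le (h : IsConjSetting q σ e) (z : F) (hz : z ≠ 0) :
    #{g : F | g = z * σ g} ≤ q := by
  let P : Polynomial F := Polynomial.C z * Polynomial.X ^ q - Polynomial.X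
  have hdeg : P.natDegree = q := by
    have h1 := h.one_lt
    simp only [P]
    compute_degree!
    · rw [if_neg h1.ne]
      simpa using hz
    · exact h1.le
  have hP : P ≠ 0 := by
    intro h0
    rw [h0, Polynomial.natDegree_zero] at hdeg
    exact absurd h.one_lt (by omega)
  calc #{g : F | g = z * σ g} ≤ #P.roots.toFinset := by
        refine card_le_card fun g hg => ?_
        rw [mem_filter] at hg
        rw [Multiset.mem_toFinset, Polynomial.mem_roots hP, Polynomial.IsRoot]
        simp only [P, Polynomial.eval_sub, Polynomial.eval_mul, Polynomial.eval_C,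
          Polynomial.eval_pow, Polynomial.eval_X, ← h.map_eq]
        rw [← hg.2, sub_self]
    _ ≤ P.roots.card := Multiset.toFinset_card_le _
    _ ≤ P.natDegree := P.card_roots'
    _ = q := hdeg

open Finset Classical in
theorem card_filter (h : IsConjSetting q σ e) {z : F} (hz : z * σ z = 1) :
    #{g : F | g = z * σ g} = q := by
  have hz0 : z ≠ 0 := left_ne_zero_of_mul_eq_one hz
  refine le_antisymm (h.card_filter_le z hz0) ?_
  have h1 : #(univ : Finset F) ≤ #{g : F | g = z * σ g} *
      #((univ : Finset F).image fun g => g - z * σ g) := by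
    refine card_le_mul_card_image _ _ fun b hb => ?_
    obtain ⟨x, -, rfl⟩ := mem_image.1 hb
    refine card_le_card_of_injOn (fun y => y - x) (fun y hy => ?_) (fun _ _ _ _ => sub_left_inj.1)
    simp only [coe_filter, mem_univ, true_and, Set.mem_ofPred_eq, map_sub] at hy ⊢
    linear_combination hy
  have h2 : #((univ : Finset F).image fun g => g - z * σ g) ≤ q := by
    refine le_trans (card_le_card fun y hy => ?_) (h.card_filter_le (-z) (neg_ne_zero.2 hz0))
    obtain ⟨x, -, rfl⟩ := mem_image.1 hy
    simp only [mem_filter, mem_univ, true_and, map_sub, map_mul, h.invol]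
    linear_combination -x * hz
  rw [card_univ, h.card_eq, pow_two] at h1
  exact Nat.le_of_mul_le_mul_right (h1.trans (Nat.mul_le_mul_left _ h2))
    (by have := h.one_lt; omega)

theorem exists_antisymm (h : IsConjSetting q σ e) : ∃ θ : F, θ ≠ 0 ∧ σ θ = -θ := by
  classical
  have hc := h.card_filter (z := -1) (by simp)
  obtain ⟨θ, hθ, h0⟩ := Finset.exists_mem_ne (hc ▸ h.one_lt) 0
  rw [Finset.mem_filter] at hθ
  exact ⟨θ, h0, by linear_combination hθ.2⟩

theorem binGauss_scale_sq (β κ : F) {l : F} (hl : l ≠ 0) (hσ : σ l = l) :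
    binGauss σ e (l ^ 2 * β) (l ^ 2 * κ) = binGauss σ e β κ := by
  unfold binGauss
  rw [← Equiv.sum_comp (Equiv.mulLeft₀ l hl) (fun g => e (β * g ^ 2 + κ * (g * σ g)))]
  refine Finset.sum_congr rfl fun g _ => ?_
  rw [Equiv.mulLeft₀_apply, map_mul, hσ]
  congr 1
  ring

/-- A nondegenerate binary form over the fixed field represents every nonzero element. -/
theorem exists_repr (h : IsConjSetting q σ e) {d l : F} (hd : d ≠ 0) (hσd : σ d = d)
    (hσl : σ l = l) : ∃ x y : F, σ x = x ∧ σ y = y ∧ x ^ 2 - d * y ^ 2 = l := by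
  classical
  let k : Subfield F := (RingHom.id F).eqLocusField σ
  have hk : ∀ x, x ∈ k ↔ x = σ x := fun x => Iff.rfl
  have hcard : Fintype.card k = q := by
    rw [Fintype.card_subtype, ← h.card_filter (z := 1) (by simp)]
    simp only [hk, one_mul]
  let d' : k := ⟨d, hσd.symm⟩
  let l' : k := ⟨l, hσl.symm⟩
  have hd' : d' ≠ 0 := fun h0 => hd (congrArg Subtype.val h0)
  obtain ⟨x, y, hxy⟩ := FiniteField.exists_root_sum_quadratic (R := k)
    (f := Polynomial.X ^ 2 - Polynomial.C l') (g := Polynomial.C (-d') * Polynomial.X ^ 2)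
    (by compute_degree!) (by rw [Polynomial.degree_C_mul_X_pow _ (neg_ne_zero.2 hd')]; rfl)
    (by rw [hcard]; exact Nat.odd_iff.1 h.odd)
  refine ⟨x, y, ((hk _).1 x.2).symm, ((hk _).1 y.2).symm, ?_⟩
  have := congrArg Subtype.val hxy
  simp [d', l'] at this
  linear_combination this

theorem binGauss_scale (h : IsConjSetting q σ e) {β κ l : F} (hκ : σ κ = κ)
    (hd : κ ^ 2 - β * σ β ≠ 0) (hl : l ≠ 0) (hσl : σ l = l) :
    binGauss σ e (l * β) (l * κ) = binGauss σ e β κ := by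
  obtain ⟨θ, hθ, hσθ⟩ := h.exists_antisymm
  obtain ⟨x, y, hx, hy, hxy⟩ := h.exists_repr (d := θ ^ 2 * (κ ^ 2 - β * σ β)) (l := l)
    (mul_ne_zero (pow_ne_zero 2 hθ) hd)
    (by simp only [map_mul, map_sub, map_pow, hσθ, hκ, h.invol]; ring) hσl
  let J : F → F := fun g => θ * (κ * g + σ β * σ g)
  have hinj : Function.Injective fun g => x * g + y * J g := by
    have key : ∀ g, x * (x * g + y * J g) - y * J (x * g + y * J g) = l * g := fun g => by
      simp only [J, map_mul, map_add, h.invol, hσθ, hκ, hx, hy]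
      linear_combination g * hxy
    intro g g' hg
    simp only at hg
    have := key g
    rw [hg, key g'] at this
    exact (mul_left_cancel₀ hl this).symm
  unfold binGauss
  rw [← (Finite.injective_iff_bijective.1 hinj).sum_comp (fun g => e (β * g ^ 2 + κ * (g * σ g)))]
  refine Finset.sum_congr rfl fun g _ => h.char_congr ?_
  simp only [J, map_mul, map_add, map_pow, h.invol, hσθ, hκ, hx, hy, ← hxy, map_sub, map_neg]
  ring

theorem card_filter_neg (h : IsConjSetting q σ e) [DecidableEq F] :
    Finset.card {c : F | c + σ c = 0} = q := by
  classical
  rw [← h.card_filter (z := -1) (by simp)]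
  congr 1
  ext c
  simp only [Finset.mem_filter, Finset.mem_univ, true_and, neg_one_mul, eq_neg_iff_add_eq_zero]

theorem binGauss_zero (h : IsConjSetting q σ e) : binGauss σ e 0 0 = (q : ℂ) ^ 2 := by
  simp [binGauss, h.card_eq]

open Finset Classical in
theorem sq_mul_card_zeros (h : IsConjSetting q σ e) {β κ : F} (hκ : σ κ = κ)
    (hd : κ ^ 2 - β * σ β ≠ 0) :
    (q : ℂ) ^ 2 * #{g : F | β * g ^ 2 + σ β * σ g ^ 2 + 2 * κ * (g * σ g) = 0} =
      q ^ 3 + (q ^ 2 - q) * binGauss σ e β κ := by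
  have h1 : ∑ c, binGauss σ e ((c + σ c) * β) ((c + σ c) * κ) =
      (q : ℂ) ^ 2 * #{g : F | β * g ^ 2 + σ β * σ g ^ 2 + 2 * κ * (g * σ g) = 0} := by
    unfold binGauss
    rw [sum_comm, Finset.card_filter, Nat.cast_sum, mul_sum]
    refine sum_congr rfl fun g _ => ?_
    rw [Nat.cast_ite, Nat.cast_one, Nat.cast_zero, mul_ite, mul_one, mul_zero, ← h.sum_char]
    refine sum_congr rfl fun c _ => h.char_congr ?_
    simp only [map_add, map_mul, map_pow, map_ofNat, h.invol, hκ]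
    ring
  rw [← h1, ← sum_filter_add_sum_filter_not univ (fun c => c + σ c = 0)]
  congr 1
  · rw [sum_congr rfl (g := fun _ => (q : ℂ) ^ 2), sum_const, h.card_filter_neg, nsmul_eq_mul]
    · ring
    · intro c hc
      rw [(mem_filter.1 hc).2, zero_mul, zero_mul, h.binGauss_zero]
  · rw [sum_congr rfl (g := fun _ => binGauss σ e β κ), sum_const, nsmul_eq_mul]
    · congr 1
      have := card_filter_add_card_filter_not (s := (univ : Finset F)) (fun c => c + σ c = 0)
      rw [card_univ, h.card_eq, h.card_filter_neg] at this
      rw [eq_sub_iff_add_eq, add_comm]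
      exact_mod_cast this
    · intro c hc
      exact h.binGauss_scale hκ hd (mem_filter.1 hc).2 (by rw [map_add, h.invol, add_comm])

open Finset Classical in
theorem binGauss_of_fixed (h : IsConjSetting q σ e) {β κ s : F} (hκ : σ κ = κ) (hβ : β ≠ 0)
    (hs : κ ^ 2 - β * σ β = s ^ 2) (hs0 : s ≠ 0) (hσ : σ s = s) :
    binGauss σ e β κ = -q := by
  have hN : β * σ β ≠ 0 := mul_ne_zero hβ (by simpa using hβ)
  have aux : ∀ s : F, κ ^ 2 - β * σ β = s ^ 2 → s ≠ 0 → σ s = s → ∀ g,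
      g = (-κ + s) / β * σ g → g = 0 := by
    intro s hs hs0 hσ g hg
    by_contra hg0
    have h1 : β * g = (-κ + s) * σ g := by
      rw [div_mul_eq_mul_div, eq_div_iff hβ] at hg
      rw [mul_comm, hg]
    have h2 := congrArg σ h1
    simp only [map_mul, map_add, map_neg, hκ, hσ, h.invol] at h2
    have hσg : σ g ≠ 0 := by simpa using hg0
    have h3 : β * σ β = (-κ + s) ^ 2 := by
      refine mul_right_cancel₀ (mul_ne_zero hg0 hσg) ?_
      linear_combination σ β * σ g * h1 + (-κ + s) * σ g * h2
    have h4 : s = κ := by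
      refine mul_left_cancel₀ (mul_ne_zero h.two_ne hs0) ?_
      linear_combination -hs - h3
    exact hN (by rw [h3, h4]; ring)
  have hZ : ({g : F | β * g ^ 2 + σ β * σ g ^ 2 + 2 * κ * (g * σ g) = 0} : Finset F) = {0} := by
    ext g
    rw [mem_filter, mem_singleton, zeros_iff hβ hs]
    constructor
    · rintro ⟨-, hg | hg⟩
      · exact aux s hs hs0 hσ g hg
      · exact aux (-s) (by rw [hs, neg_sq]) (neg_ne_zero.2 hs0) (by rw [map_neg, hσ]) g
          (by rwa [← sub_eq_add_neg])
    · rintro rfl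
      simp
  have := h.sq_mul_card_zeros hκ (by rw [hs]; exact pow_ne_zero 2 hs0)
  rw [hZ, card_singleton, Nat.cast_one] at this
  have hq : (q : ℂ) * (q - 1) ≠ 0 := by
    have := h.one_lt
    refine mul_ne_zero (by exact_mod_cast (by omega)) (sub_ne_zero.2 (by exact_mod_cast this.ne'))
  refine mul_left_cancel₀ hq ?_
  linear_combination -this

open Finset Classical in
theorem binGauss_of_antisymm (h : IsConjSetting q σ e) {β κ s : F} (hκ : σ κ = κ) (hβ : β ≠ 0)
    (hs : κ ^ 2 - β * σ β = s ^ 2) (hs0 : s ≠ 0) (hσ : σ s = -s) :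
    binGauss σ e β κ = q := by
  have hσβ : σ β ≠ 0 := by simpa using hβ
  have hZ : ({g : F | β * g ^ 2 + σ β * σ g ^ 2 + 2 * κ * (g * σ g) = 0} : Finset F) =
      ({g : F | g = (-κ + s) / β * σ g} : Finset F) ∪
        ({g : F | g = (-κ - s) / β * σ g} : Finset F) := by
    ext g
    simp only [mem_filter, mem_univ, true_and, mem_union]
    exact zeros_iff hβ hs
  have hI : ({g : F | g = (-κ + s) / β * σ g} : Finset F) ∩
        ({g : F | g = (-κ - s) / β * σ g} : Finset F) = {0} := by
    ext g
    simp only [mem_filter, mem_univ, true_and, mem_inter, mem_singleton]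
    constructor
    · rintro ⟨h1, h2⟩
      rw [div_mul_eq_mul_div, eq_div_iff hβ] at h1 h2
      have : 2 * s * σ g = 0 := by linear_combination h2 - h1
      simpa [h.two_ne, hs0] using this
    · rintro rfl
      simp
  have hc := card_union_add_card_inter ({g : F | g = (-κ + s) / β * σ g} : Finset F)
    ({g : F | g = (-κ - s) / β * σ g} : Finset F)
  rw [← hZ, hI, card_singleton, h.card_filter, h.card_filter] at hc
  · have := h.sq_mul_card_zeros hκ (by rw [hs]; exact pow_ne_zero 2 hs0)
    have hc' : (#{g : F | β * g ^ 2 + σ β * σ g ^ 2 + 2 * κ * (g * σ g) = 0} : ℂ) + 1 = q + q := by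
      exact_mod_cast hc
    have hq : (q : ℂ) * (q - 1) ≠ 0 := by
      have := h.one_lt
      refine mul_ne_zero (by exact_mod_cast (by omega)) (sub_ne_zero.2 (by exact_mod_cast this.ne'))
    refine mul_left_cancel₀ hq ?_
    linear_combination -this + (q : ℂ) ^ 2 * hc'
  all_goals
    simp only [map_div₀, map_add, map_sub, map_neg, hκ, hσ]
    field_simp
    linear_combination hs

theorem planeSum_eq (h : IsConjSetting q σ e) (P P' R R' : F) {b κ : F} (hκ : σ κ = κ)
    (hD : b * σ b - κ ^ 2 ≠ 0) :
    planeSum σ e P P' R R' b κ =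
      binGauss σ e ((b * σ b - κ ^ 2)⁻¹ * (-σ b * (P * R + P' * R')))
        ((b * σ b - κ ^ 2)⁻¹ *
          (κ * (P * σ R' + P' * σ R + σ (P * σ R' + P' * σ R)) / 2)) := by
  classical
  unfold planeSum binGauss
  refine Finset.sum_congr rfl fun t _ => ?_
  set D := b * σ b - κ ^ 2 with hDdef
  have hσD : σ D = D := by
    simp only [hDdef, map_sub, map_mul, map_pow, h.invol, hκ]
    ring
  have hiff : ∀ s : F × F,
      (b * s.1 + κ * σ s.2 + t * R = 0 ∧ b * s.2 + κ * σ s.1 + t * R' = 0) ↔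
        s = (D⁻¹ * (-σ b * t * R + κ * σ t * σ R'), D⁻¹ * (-σ b * t * R' + κ * σ t * σ R)) := by
    rintro ⟨r, r'⟩
    rw [Prod.mk.injEq]
    simp only
    constructor
    · rintro ⟨h1, h2⟩
      have h1' := congrArg σ h1
      have h2' := congrArg σ h2
      simp only [map_add, map_mul, map_zero, hκ, h.invol] at h1' h2'
      rw [eq_inv_mul_iff_mul_eq₀ hD, eq_inv_mul_iff_mul_eq₀ hD]
      constructor
      · linear_combination σ b * h1 - κ * h2'
      · linear_combination σ b * h2 - κ * h1'
    · rintro ⟨rfl, rfl⟩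
      simp only [map_add, map_mul, map_neg, map_inv₀, hσD, hκ, h.invol]
      constructor <;> field_simp <;> rw [hDdef] <;> ring
  simp only [hiff]
  rw [Finset.sum_ite_eq' Finset.univ, if_pos (Finset.mem_univ _)]
  refine h.char_congr ?_
  have h2 := h.two_ne
  simp only [map_add, map_mul, map_neg, map_inv₀, map_div₀, map_ofNat, map_pow, hσD, hκ, h.invol]
  field_simp
  ring

theorem planeSum_zero (h : IsConjSetting q σ e) {P P' R R' : F}
    (hu : ¬(P = 0 ∧ P' = 0 ∧ R = 0 ∧ R' = 0)) : planeSum σ e P P' R R' 0 0 = (q : ℂ) ^ 4 := by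
  classical
  unfold planeSum
  simp only [zero_mul, zero_add]
  rw [Finset.sum_eq_single_of_mem 0 (Finset.mem_univ _)]
  · simp [h.card_eq]
    ring
  · intro t _ ht
    by_cases hR : R = 0 ∧ R' = 0
    · have hterm : ∀ s : F × F, (if t * R = 0 ∧ t * R' = 0 then e (t * (s.1 * P + s.2 * P')) else 0)
          = e (s.1 * (t * P)) * e (s.2 * (t * P')) := fun s => by
        rw [if_pos (by simp [hR.1, hR.2]), ← AddChar.map_add_eq_mul]
        congr 1
        ring
      simp only [hterm, Fintype.sum_prod_type]
      rw [← Finset.sum_mul_sum, h.sum_char, h.sum_char]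
      have : ¬(t * P = 0 ∧ t * P' = 0) := by
        simp only [mul_eq_zero, ht, false_or]
        exact fun hP => hu ⟨hP.1, hP.2, hR⟩
      split_ifs with h1 h2
      · exact absurd ⟨h1, h2⟩ this
      all_goals simp
    · refine Finset.sum_eq_zero fun s _ => if_neg ?_
      simpa [ht] using hR

theorem planeSum_zero_zero (h : IsConjSetting q σ e) :
    planeSum σ e 0 0 0 0 0 0 = (q : ℂ) ^ 6 := by
  simp [planeSum, h.card_eq]
  ring

open Finset Classical in
theorem count_eq (h : IsConjSetting q σ e) (P P' R R' μ : F) {ζ : F} (hζ : σ ζ = ζ) :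
    (q : ℂ) ^ 6 * #{w : ((F × F) × (F × F)) × F |
      w.1.1.1 * w.1.2.1 + w.1.1.2 * w.1.2.2 = μ * w.2 ^ 2 ∧
      (w.1.1.1 * σ w.1.2.2 + w.1.1.2 * σ w.1.2.1) + σ (w.1.1.1 * σ w.1.2.2 + w.1.1.2 * σ w.1.2.1) =
        2 * ζ * (w.2 * σ w.2) ∧
      w.1.1.1 * R + w.1.2.1 * P + w.1.1.2 * R' + w.1.2.2 * P' = 0} =
    (q : ℂ) ^ 4 * ∑ b, ∑ c, binGauss σ e (-b * μ) (-((c + σ c) * ζ)) *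
      planeSum σ e P P' R R' b (c + σ c) := by
  have h1 : ∀ A B C : F, (q : ℂ) ^ 6 * (if A = 0 ∧ B = 0 ∧ C = 0 then 1 else 0) =
      ∑ b, ∑ c, ∑ t, e (b * A + c * B + t * C) := fun A B C => by
    simp only [AddChar.map_add_eq_mul, ← mul_sum, ← sum_mul, h.sum_char]
    simp only [ite_and]
    split_ifs <;> ring
  have h2 : ∀ b c t g : F, ∀ s : F × F, ∑ u : F × F,
      e (b * (u.1 * s.1 + u.2 * s.2 - μ * g ^ 2) +
        c * (u.1 * σ s.2 + u.2 * σ s.1 + σ (u.1 * σ s.2 + u.2 * σ s.1) - 2 * ζ * (g * σ g)) +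
        t * (u.1 * R + s.1 * P + u.2 * R' + s.2 * P')) =
      e (-b * μ * g ^ 2 + -((c + σ c) * ζ) * (g * σ g)) * ((q : ℂ) ^ 4 *
        if b * s.1 + (c + σ c) * σ s.2 + t * R = 0 ∧ b * s.2 + (c + σ c) * σ s.1 + t * R' = 0 then
          e (t * (s.1 * P + s.2 * P')) else 0) := fun b c t g s => by
    have h3 : ∀ u : F × F,
      e (b * (u.1 * s.1 + u.2 * s.2 - μ * g ^ 2) +
        c * (u.1 * σ s.2 + u.2 * σ s.1 + σ (u.1 * σ s.2 + u.2 * σ s.1) - 2 * ζ * (g * σ g)) +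
        t * (u.1 * R + s.1 * P + u.2 * R' + s.2 * P')) =
      e (-b * μ * g ^ 2 + -((c + σ c) * ζ) * (g * σ g)) * (e (t * (s.1 * P + s.2 * P')) *
        (e (u.1 * (b * s.1 + (c + σ c) * σ s.2 + t * R)) *
          e (u.2 * (b * s.2 + (c + σ c) * σ s.1 + t * R')))) := fun u => by
      rw [← AddChar.map_add_eq_mul, ← AddChar.map_add_eq_mul, ← AddChar.map_add_eq_mul]
      refine h.char_congr ?_
      simp only [map_add, map_sub, map_mul, map_pow, map_neg, map_ofNat, h.invol, hζ]
      ring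
    simp only [h3, ← mul_sum, Fintype.sum_prod_type, ← sum_mul, h.sum_char]
    rw [ite_and]
    split_ifs <;> ring
  rw [Finset.card_filter, Nat.cast_sum, mul_sum]
  simp only [Nat.cast_ite, Nat.cast_one, Nat.cast_zero]
  rw [sum_congr rfl (g := fun w => ∑ j : F × F × F,
      e (j.1 * (w.1.1.1 * w.1.2.1 + w.1.1.2 * w.1.2.2 - μ * w.2 ^ 2) +
        j.2.1 * (w.1.1.1 * σ w.1.2.2 + w.1.1.2 * σ w.1.2.1 +
          σ (w.1.1.1 * σ w.1.2.2 + w.1.1.2 * σ w.1.2.1) - 2 * ζ * (w.2 * σ w.2)) +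
        j.2.2 * (w.1.1.1 * R + w.1.2.1 * P + w.1.1.2 * R' + w.1.2.2 * P')))]
  · rw [sum_comm, Fintype.sum_prod_type, mul_sum]
    refine sum_congr rfl fun b _ => ?_
    rw [Fintype.sum_prod_type, mul_sum]
    refine sum_congr rfl fun c _ => ?_
    trans ∑ t, ∑ g, ∑ s : F × F, e (-b * μ * g ^ 2 + -((c + σ c) * ζ) * (g * σ g)) * ((q : ℂ) ^ 4 *
        if b * s.1 + (c + σ c) * σ s.2 + t * R = 0 ∧ b * s.2 + (c + σ c) * σ s.1 + t * R' = 0 then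
          e (t * (s.1 * P + s.2 * P')) else 0)
    · refine sum_congr rfl fun t _ => ?_
      rw [Fintype.sum_prod_type_right]
      refine sum_congr rfl fun g _ => ?_
      rw [Fintype.sum_prod_type_right]
      exact sum_congr rfl fun s _ => h2 b c t g s
    · unfold binGauss planeSum
      rw [sum_comm, sum_mul_sum, mul_sum]
      refine sum_congr rfl fun g _ => ?_
      rw [mul_sum]
      refine sum_congr rfl fun t _ => ?_
      simp only [← mul_sum]
      ring
  · intro w _
    rw [Fintype.sum_prod_type]
    simp only [Fintype.sum_prod_type, ← h1, sub_eq_zero]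

theorem ringChar_ne_two (h : IsConjSetting q σ e) : ringChar F ≠ 2 := fun h0 =>
  h.two_ne (by simpa [h0] using CharP.cast_eq_zero F (ringChar F))

theorem two_mul_half (h : IsConjSetting q σ e) : 2 * ((q + 1) / 2) = q + 1 := by
  obtain ⟨k, rfl⟩ := h.odd
  omega

theorem half_pow_sq (h : IsConjSetting q σ e) (x : F) :
    (x ^ ((q + 1) / 2)) ^ 2 = x * σ x := by
  rw [← pow_mul, mul_comm, h.two_mul_half, h.mul_conj]

theorem sq_half_pow (h : IsConjSetting q σ e) (x : F) :
    (x ^ 2) ^ ((q + 1) / 2) = x * σ x := by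
  rw [← pow_mul, h.two_mul_half, h.mul_conj]

theorem card_half (h : IsConjSetting q σ e) :
    Fintype.card F / 2 = (q + 1) / 2 * (q - 1) := by
  rw [h.card_eq]
  obtain ⟨k, rfl⟩ := h.odd
  rw [show (2 * k + 1 + 1) / 2 = k + 1 by omega, show 2 * k + 1 - 1 = 2 * k by omega,
    show (2 * k + 1) ^ 2 = 2 * ((k + 1) * (2 * k)) + 1 by ring]
  omega

theorem conj_half_pow (h : IsConjSetting q σ e) {x : F} (hx : ¬IsSquare x) :
    σ (x ^ ((q + 1) / 2)) = -x ^ ((q + 1) / 2) := by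
  have hx0 : x ≠ 0 := by
    rintro rfl
    exact hx (IsSquare.zero)
  have h1 : x ^ (Fintype.card F / 2) = -1 :=
    (FiniteField.pow_dichotomy h.ringChar_ne_two hx0).resolve_left
      fun h1 => hx ((FiniteField.isSquare_iff h.ringChar_ne_two hx0).2 h1)
  have hq : q = (q - 1) + 1 := by
    have := h.one_lt
    omega
  rw [h.map_eq, show (x ^ ((q + 1) / 2)) ^ q = (x ^ ((q + 1) / 2)) ^ (q - 1 + 1) by rw [← hq],
    pow_succ, ← pow_mul, ← h.card_half, h1, neg_one_mul]

theorem isSquare_of_fixed (h : IsConjSetting q σ e) {x : F} (hx : σ x = x) : IsSquare x := by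
  by_contra hsq
  have hx0 : x ≠ 0 := by
    rintro rfl
    exact hsq (IsSquare.zero)
  have := h.conj_half_pow hsq
  rw [map_pow, hx, eq_neg_iff_add_eq_zero, ← two_mul] at this
  exact mul_ne_zero h.two_ne (pow_ne_zero _ hx0) this

theorem exists_isTwist (h : IsConjSetting q σ e) {ξ : F} (h0 : ξ ≠ 0) (hξ : σ (ξ ^ 2) = ξ ^ 2) :
    ∃ ω ζ, IsTwist q σ ξ ω ζ := by
  rw [map_pow, sq_eq_sq_iff_eq_or_eq_neg] at hξ
  obtain hξ | hξ := hξ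
  · exact ⟨1, ξ, one_ne_zero, h0, hξ, by simp⟩
  · obtain ⟨ω, hω⟩ := FiniteField.exists_nonsquare h.ringChar_ne_two
    have hω0 : ω ≠ 0 := by
      rintro rfl
      exact hω (IsSquare.zero)
    exact ⟨ω, _, hω0, mul_ne_zero h0 (pow_ne_zero _ hω0),
      by rw [map_mul, hξ, h.conj_half_pow hω, neg_mul_neg], rfl⟩

theorem zeta_sq (h : IsConjSetting q σ e) {ξ ω ζ : F} (ht : IsTwist q σ ξ ω ζ) :
    ζ ^ 2 = ξ ^ 2 * (ω * σ ω) := by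
  rw [ht.zeta_eq, mul_pow, h.half_pow_sq]

theorem disc_eq (h : IsConjSetting q σ e) {ξ ω ζ d b κ : F} (ht : IsTwist q σ ξ ω ζ)
    (h0 : ξ ≠ 0) (hd : 1 - (ξ ^ 2)⁻¹ = d ^ 2) (hb : b * σ b = κ ^ 2) :
    (-(κ * (2 * ζ))) ^ 2 - (-b * (2 * ω)) * σ (-b * (2 * ω)) = (2 * κ * ζ * d) ^ 2 := by
  have h1 : ξ ^ 2 * d ^ 2 = ξ ^ 2 - 1 := by
    rw [← hd]
    field_simp
  have h2 := h.zeta_sq ht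
  simp only [map_mul, map_neg, map_ofNat]
  linear_combination (4 * κ ^ 2 - 4 * κ ^ 2 * d ^ 2) * h2 - 4 * ω * σ ω * hb
    - 4 * κ ^ 2 * ω * σ ω * h1

theorem binGauss_add_eq_zero (h : IsConjSetting q σ e) {ξ₁ ω₁ ζ₁ d₁ ξ₂ ω₂ ζ₂ d₂ b κ : F}
    (ht₁ : IsTwist q σ ξ₁ ω₁ ζ₁) (hξ₁ : ξ₁ ≠ 0) (hd₁ : 1 - (ξ₁ ^ 2)⁻¹ = d₁ ^ 2) (hd₁0 : d₁ ≠ 0)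
    (hσ₁ : σ d₁ = d₁) (ht₂ : IsTwist q σ ξ₂ ω₂ ζ₂) (hξ₂ : ξ₂ ≠ 0)
    (hd₂ : 1 - (ξ₂ ^ 2)⁻¹ = d₂ ^ 2) (hd₂0 : d₂ ≠ 0) (hσ₂ : σ d₂ = -d₂) (hb0 : b ≠ 0)
    (hb : b * σ b = κ ^ 2) (hκ : σ κ = κ) :
    binGauss σ e (-b * (2 * ω₁)) (-(κ * (2 * ζ₁))) +
      binGauss σ e (-b * (2 * ω₂)) (-(κ * (2 * ζ₂))) = 0 := by
  have hκ0 : κ ≠ 0 := by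
    rintro rfl
    simp [hb0] at hb
  have h2 := h.two_ne
  have h3 := ht₁.zeta_ne
  have h4 := ht₂.zeta_ne
  have h5 := ht₁.omega_ne
  have h6 := ht₂.omega_ne
  rw [h.binGauss_of_fixed (by simp [map_ofNat, hκ, ht₁.conj_zeta]) (by simp [*])
      (h.disc_eq ht₁ hξ₁ hd₁ hb)
      (by simp [*]) (by simp [map_ofNat, hκ, ht₁.conj_zeta, hσ₁]),
    h.binGauss_of_antisymm (by simp [map_ofNat, hκ, ht₂.conj_zeta]) (by simp [*])
      (h.disc_eq ht₂ hξ₂ hd₂ hb) (by simp [*]) (by simp [map_ofNat, hκ, ht₂.conj_zeta, hσ₂]),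
    neg_add_cancel]

open Finset Classical in
theorem card_twist (h : IsConjSetting q σ e) {ξ ω ζ Q H : F} (ht : IsTwist q σ ξ ω ζ)
    (hH : σ H = H) :
    #{g : F | Q = ω * g ^ 2 ∧ H = 2 * ζ * (g * σ g)} =
      if H = 2 * ξ * Q ^ ((q + 1) / 2) then (if Q = 0 then 1 else 2) else 0 := by
  have hω := ht.omega_ne
  by_cases hsq : ∃ g, Q = ω * g ^ 2
  · obtain ⟨g₀, rfl⟩ := hsq
    have h1 : 2 * ξ * (ω * g₀ ^ 2) ^ ((q + 1) / 2) = 2 * ζ * (g₀ * σ g₀) := by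
      rw [mul_pow, h.sq_half_pow, ht.zeta_eq]
      ring
    have h2 : ({g : F | ω * g₀ ^ 2 = ω * g ^ 2 ∧ H = 2 * ζ * (g * σ g)} : Finset F) =
        if H = 2 * ζ * (g₀ * σ g₀) then {g₀, -g₀} else ∅ := by
      ext g
      rw [mem_filter, mul_right_inj' hω, sq_eq_sq_iff_eq_or_eq_neg]
      split_ifs with hc
      · simp only [mem_univ, true_and, mem_insert, mem_singleton]
        constructor
        · rintro ⟨rfl | rfl, -⟩ <;> simp
        · rintro (rfl | rfl) <;> simp [hc]
      · simp only [mem_univ, true_and, notMem_empty, iff_false]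
        rintro ⟨rfl | rfl, h3⟩
        · exact hc h3
        · exact hc (by rw [h3, map_neg, neg_mul_neg])
    rw [h2, h1]
    split_ifs with h3 h4
    · have : g₀ = 0 := by simpa [hω] using h4
      simp [this]
    · rw [card_pair]
      intro h5
      refine h4 ?_
      have : 2 * g₀ = 0 := by linear_combination h5
      have : g₀ = 0 := by simpa [h.two_ne] using this
      simp [this]
    · simp
  · rw [filter_false_of_mem fun g _ hg => hsq ⟨g, hg.1⟩, card_empty, if_neg]
    intro h1
    have h2 : ¬IsSquare (Q / ω) := by
      rintro ⟨g, hg⟩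
      exact hsq ⟨g, by rw [pow_two, ← hg]; field_simp⟩
    have h3 : Q ≠ 0 := by
      rintro rfl
      exact hsq ⟨0, by simp⟩
    have h4 : H = 2 * ζ * (Q / ω) ^ ((q + 1) / 2) := by
      rw [h1, ht.zeta_eq, div_pow]
      field_simp
    have h5 := hH
    rw [h4, map_mul, map_mul, ht.conj_zeta, h.conj_half_pow h2, map_ofNat] at h5
    have h6 : 2 * (2 * ζ * (Q / ω) ^ ((q + 1) / 2)) = 0 := by linear_combination -h5
    refine absurd h6 ?_
    have h7 : (Q / ω) ^ ((q + 1) / 2) ≠ 0 := pow_ne_zero _ (div_ne_zero h3 hω)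
    simp only [mul_eq_zero, h.two_ne, ht.zeta_ne, h7, or_self, not_false_eq_true]

open Finset Classical in
theorem card_twist_add (h : IsConjSetting q σ e) {ξ₁ ω₁ ζ₁ ξ₂ ω₂ ζ₂ Q H : F}
    (ht₁ : IsTwist q σ ξ₁ ω₁ ζ₁) (ht₂ : IsTwist q σ ξ₂ ω₂ ζ₂) (hne : ξ₁ ≠ ξ₂)
    (hH : σ H = H) :
    #{g : F | Q = ω₁ * g ^ 2 ∧ H = 2 * ζ₁ * (g * σ g)} +
      #{g : F | Q = ω₂ * g ^ 2 ∧ H = 2 * ζ₂ * (g * σ g)} =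
      2 * if H = 2 * ξ₁ * Q ^ ((q + 1) / 2) ∨ H = 2 * ξ₂ * Q ^ ((q + 1) / 2) then 1 else 0 := by
  rw [h.card_twist ht₁ hH, h.card_twist ht₂ hH]
  have hm : (q + 1) / 2 ≠ 0 := by
    have := h.two_mul_half
    omega
  by_cases hQ : Q = 0
  · subst hQ
    simp only [zero_pow hm, mul_zero, or_self, if_true]
    split_ifs <;> rfl
  · rw [if_neg hQ]
    have : ¬(H = 2 * ξ₁ * Q ^ ((q + 1) / 2) ∧ H = 2 * ξ₂ * Q ^ ((q + 1) / 2)) := by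
      rintro ⟨h1, h2⟩
      rw [h1] at h2
      exact hne (mul_left_cancel₀ h.two_ne (mul_right_cancel₀ (pow_ne_zero _ hQ) h2))
    split_ifs <;> simp_all

theorem exists_scale (h : IsConjSetting q σ e) (a : F) {t : F} (ht : σ t = t) :
    ∃ n : F, n ≠ 0 ∧ σ n = n ∧ ∀ b κ : F, σ κ = κ → b * σ b - κ ^ 2 ≠ 0 →
      binGauss σ e ((b * σ b - κ ^ 2)⁻¹ * (-σ b * a)) ((b * σ b - κ ^ 2)⁻¹ * (κ * t / 2)) =
        binGauss σ e (n * (-σ b * a)) (n * (κ * t / 2)) := by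
  classical
  have h2 := h.two_ne
  obtain ⟨n, hn, hσn, hn'⟩ : ∃ n : F, n ≠ 0 ∧ σ n = n ∧
      (a ≠ 0 → t ^ 2 - 4 * (a * σ a) ≠ 0 → n = (t ^ 2 - 4 * (a * σ a)) * (a * σ a)) := by
    by_cases h1 : a ≠ 0 ∧ t ^ 2 - 4 * (a * σ a) ≠ 0
    · refine ⟨_, mul_ne_zero h1.2 (mul_ne_zero h1.1 (by simpa using h1.1)), ?_, fun _ _ => rfl⟩
      simp only [map_mul, map_sub, map_pow, ht, h.invol, map_ofNat]
      ring
    · exact ⟨1, one_ne_zero, map_one _, fun h3 h4 => absurd ⟨h3, h4⟩ h1⟩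
  refine ⟨n, hn, hσn, fun b κ hκ hD => ?_⟩
  have hσD : σ (b * σ b - κ ^ 2) = b * σ b - κ ^ 2 := by
    simp only [map_sub, map_mul, map_pow, h.invol, hκ]
    ring
  have hσy : σ (κ * t / 2) = κ * t / 2 := by simp [map_ofNat, hκ, ht]
  by_cases hd : (κ * t / 2) ^ 2 - (-σ b * a) * σ (-σ b * a) = 0
  · have hd' : κ ^ 2 * t ^ 2 = 4 * (b * σ b) * (a * σ a) := by
      simp only [map_mul, map_neg, h.invol] at hd
      field_simp at hd
      linear_combination hd
    by_cases ha : a = 0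
    · subst ha
      have : κ * t = 0 := by simpa using hd'
      simp [this]
    · have hσa : σ a ≠ 0 := by simpa using ha
      have hκ0 : κ ≠ 0 := by
        rintro rfl
        have : (4 : F) ≠ 0 := by
          rw [show (4 : F) = 2 * 2 by norm_num]
          exact mul_ne_zero h2 h2
        have : b = 0 := by simpa [*] using hd'
        simp [this] at hD
      have h4 : 4 * (a * σ a) * (b * σ b - κ ^ 2) = κ ^ 2 * (t ^ 2 - 4 * (a * σ a)) := by
        linear_combination -hd'
      have h5 : t ^ 2 - 4 * (a * σ a) ≠ 0 := by
        intro h6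
        rw [h6, mul_zero] at h4
        have : (4 : F) ≠ 0 := by
          rw [show (4 : F) = 2 * 2 by norm_num]
          exact mul_ne_zero h2 h2
        simp [*] at h4
      have h6 := hn' ha h5
      set D := b * σ b - κ ^ 2 with hDdef
      have h7 : n = (2 * (a * σ a) * D / κ) ^ 2 * D⁻¹ := by
        rw [h6]
        field_simp
        linear_combination -h4
      rw [h7, mul_assoc, mul_assoc _ D⁻¹, binGauss_scale_sq]
      · exact div_ne_zero (mul_ne_zero (mul_ne_zero h2 (mul_ne_zero ha hσa)) hD) hκ0
      · simp only [map_div₀, map_mul, map_ofNat, hσD, hκ, h.invol]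
        ring
  · rw [h.binGauss_scale hσy hd (inv_ne_zero hD) (by rw [map_inv₀, hσD]),
      h.binGauss_scale hσy hd hn hσn]

open Finset Classical in
theorem sum_binGauss_mul (h : IsConjSetting q σ e) (ω a : F) {ζ n t : F} (hζ : σ ζ = ζ)
    (hn : σ n = n) (ht : σ t = t) :
    ∑ b, ∑ c, binGauss σ e (-b * (2 * ω)) (-((c + σ c) * (2 * ζ))) *
      binGauss σ e (n * (-σ b * a)) (n * ((c + σ c) * t / 2)) =
    (q : ℂ) ^ 4 * twistCount σ ω ζ n a t := by
  have h1 : ∀ b c g τ : F, e (-b * (2 * ω) * g ^ 2 + -((c + σ c) * (2 * ζ)) * (g * σ g)) *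
      e (n * (-σ b * a) * τ ^ 2 + n * ((c + σ c) * t / 2) * (τ * σ τ)) =
      e (b * -(2 * ω * g ^ 2 + n * σ a * σ τ ^ 2)) *
        e (c * -(2 * (2 * ζ) * (g * σ g) - n * t * (τ * σ τ))) := fun b c g τ => by
    rw [← AddChar.map_add_eq_mul, ← AddChar.map_add_eq_mul]
    refine h.char_congr ?_
    have h2 := h.two_ne
    simp only [map_add, map_sub, map_mul, map_pow, map_neg, map_div₀, map_ofNat, h.invol, hζ, hn,
      ht]
    field_simp
    ring
  unfold twistCount
  rw [Finset.card_filter, Nat.cast_sum, mul_sum, Fintype.sum_prod_type]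
  simp only [binGauss, sum_mul_sum, h1]
  rw [sum_congr rfl fun b _ => sum_comm, sum_comm]
  refine sum_congr rfl fun g _ => ?_
  rw [sum_congr rfl fun b _ => sum_comm, sum_comm]
  refine sum_congr rfl fun τ _ => ?_
  rw [← sum_mul_sum, h.sum_char, h.sum_char]
  simp only [neg_eq_zero, sub_eq_zero, ite_and]
  split_ifs <;> simp
  ring

open Finset in
theorem twistCount_cases (h : IsConjSetting q σ e) {ξ ω ζ n a t : F} (hT : IsTwist q σ ξ ω ζ)
    (hn : n ≠ 0) (hσn : σ n = n) (ht : σ t = t) :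
    (a = 0 ∧ t = 0 ∧ twistCount σ ω ζ n a t = q ^ 2) ∨
      (¬(a = 0 ∧ t = 0) ∧ twistCount σ ω ζ n a t = 1) ∨
      (a ≠ 0 ∧ 4 * ξ ^ 2 * (a * σ a) = t ^ 2 ∧ twistCount σ ω ζ n a t + 1 = 2 * q ^ 2) := by
  classical
  have h2 := h.two_ne
  have hω := hT.omega_ne
  have hζ := hT.zeta_ne
  by_cases ha : a = 0
  · subst ha
    by_cases ht0 : t = 0
    · subst ht0
      refine Or.inl ⟨rfl, rfl, ?_⟩
      unfold twistCount
      rw [← h.card_eq, ← card_univ (α := F),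
        ← card_image_of_injective univ (Prod.mk_right_injective (0 : F))]
      congr 1
      ext ⟨g, τ⟩
      simp only [mem_filter, mem_univ, true_and, mem_image, Prod.mk.injEq, exists_eq_right]
      constructor
      · rintro ⟨h3, -⟩
        exact (by simpa [h2, hω] using h3 : g = 0).symm
      · rintro rfl
        simp
    · refine Or.inr (Or.inl ⟨fun h3 => ht0 h3.2, ?_⟩)
      unfold twistCount
      rw [card_eq_one]
      refine ⟨(0, 0), ?_⟩
      ext ⟨g, τ⟩
      simp only [mem_filter, mem_univ, true_and, mem_singleton, Prod.mk.injEq]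
      constructor
      · rintro ⟨h3, h4⟩
        have hg : g = 0 := by simpa [h2, hω] using h3
        subst hg
        refine ⟨rfl, ?_⟩
        simpa [hn, ht0] using h4
      · rintro ⟨rfl, rfl⟩
        simp
  · refine Or.inr ?_
    have hσa : σ a ≠ 0 := by simpa using ha
    by_cases hex : ∃ g₀ τ₀ : F, τ₀ ≠ 0 ∧ 2 * ω * g₀ ^ 2 + n * σ a * σ τ₀ ^ 2 = 0 ∧
      2 * (2 * ζ) * (g₀ * σ g₀) = n * t * (τ₀ * σ τ₀)
    · obtain ⟨g₀, τ₀, hτ, h3, h4⟩ := hex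
      have hστ : σ τ₀ ≠ 0 := by simpa using hτ
      refine Or.inr ⟨ha, ?_, ?_⟩
      · have h5 := congrArg σ h3
        simp only [map_add, map_mul, map_pow, map_zero, map_ofNat, h.invol, hσn] at h5
        have h6 := h.zeta_sq hT
        have h7 : n ^ 2 * (τ₀ * σ τ₀) ^ 2 ≠ 0 :=
          mul_ne_zero (pow_ne_zero 2 hn) (pow_ne_zero 2 (mul_ne_zero hτ hστ))
        refine mul_left_cancel₀ h7 ?_
        linear_combination
          (n * t * (τ₀ * σ τ₀) + 2 * (2 * ζ) * (g₀ * σ g₀)) * h4 - 16 * (g₀ * σ g₀) ^ 2 * h6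
          + 4 * ξ ^ 2 * n * a * τ₀ ^ 2 * h3 - 8 * ξ ^ 2 * ω * g₀ ^ 2 * h5
      · set x := g₀ / σ τ₀ with hx
        have hσx : σ x = σ g₀ / τ₀ := by rw [hx, map_div₀, h.invol]
        have hx1 : 2 * ω * x ^ 2 + n * σ a = 0 := by
          rw [hx]
          field_simp
          linear_combination h3
        have hx2 : 2 * (2 * ζ) * (x * σ x) = n * t := by
          rw [hσx, hx]
          field_simp
          linear_combination h4
        have hx0 : x ≠ 0 := by
          rintro hx0
          rw [hx0] at hx1
          simp [hn, ha] at hx1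
        have hS : ({w : F × F | 2 * ω * w.1 ^ 2 + n * σ a * σ w.2 ^ 2 = 0 ∧
            2 * (2 * ζ) * (w.1 * σ w.1) = n * t * (w.2 * σ w.2)} : Finset (F × F)) =
            univ.image (fun τ => (x * σ τ, τ)) ∪ univ.image (fun τ => (-x * σ τ, τ)) := by
          ext ⟨g, τ⟩
          have h5 : 2 * ω * g ^ 2 + n * σ a * σ τ ^ 2 = 0 ↔ g ^ 2 = (x * σ τ) ^ 2 := by
            rw [← sub_eq_zero (a := g ^ 2),
              show 2 * ω * g ^ 2 + n * σ a * σ τ ^ 2 = 2 * ω * (g ^ 2 - (x * σ τ) ^ 2) by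
                linear_combination σ τ ^ 2 * hx1]
            simp [h2, hω]
          simp only [mem_filter, mem_univ, true_and, mem_union, mem_image, Prod.mk.injEq, h5,
            sq_eq_sq_iff_eq_or_eq_neg, exists_eq_right]
          constructor
          · rintro ⟨rfl | rfl, -⟩
            · simp
            · simp
          · rintro (rfl | rfl)
            · refine ⟨Or.inl rfl, ?_⟩
              rw [map_mul, h.invol]
              linear_combination (τ * σ τ) * hx2
            · refine ⟨Or.inr (by ring), ?_⟩
              rw [map_mul, map_neg, h.invol]
              linear_combination (τ * σ τ) * hx2
        have hI : univ.image (fun τ => (x * σ τ, τ)) ∩ univ.image (fun τ => (-x * σ τ, τ)) =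
            {((0 : F), (0 : F))} := by
          ext ⟨g, τ⟩
          simp only [mem_univ, true_and, mem_inter, mem_image, Prod.mk.injEq, exists_eq_right,
            mem_singleton]
          constructor
          · rintro ⟨rfl, h5⟩
            have h6 : 2 * x * σ τ = 0 := by linear_combination -h5
            have : τ = 0 := by simpa [h2, hx0] using h6
            simp [this]
          · rintro ⟨rfl, rfl⟩
            simp
        have hc := card_union_add_card_inter (univ.image fun τ => (x * σ τ, τ))
          (univ.image fun τ => (-x * σ τ, τ))
        rw [← hS, hI, card_singleton, card_image_of_injective, card_image_of_injective, card_univ,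
          h.card_eq, ← two_mul] at hc
        · unfold twistCount
          convert hc
        · exact fun _ _ h5 => (Prod.mk.inj h5).2
        · exact fun _ _ h5 => (Prod.mk.inj h5).2
    · refine Or.inl ⟨fun h3 => ha h3.1, ?_⟩
      unfold twistCount
      rw [card_eq_one]
      refine ⟨(0, 0), ?_⟩
      ext ⟨g, τ⟩
      simp only [mem_filter, mem_univ, true_and, mem_singleton, Prod.mk.injEq]
      constructor
      · rintro ⟨h3, h4⟩
        have hτ : τ = 0 := by
          by_contra hτ
          exact hex ⟨g, τ, hτ, h3, h4⟩
        subst hτ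
        exact ⟨by simpa [h2, hω] using h3, rfl⟩
      · rintro ⟨rfl, rfl⟩
        simp

theorem twistCount_add (h : IsConjSetting q σ e) {ξ₁ ω₁ ζ₁ ξ₂ ω₂ ζ₂ n a t : F}
    (hT₁ : IsTwist q σ ξ₁ ω₁ ζ₁) (hT₂ : IsTwist q σ ξ₂ ω₂ ζ₂) (hne : ξ₁ ^ 2 ≠ ξ₂ ^ 2)
    (hn : n ≠ 0) (hσn : σ n = n) (ht : σ t = t) :
    (twistCount σ ω₁ ζ₁ n a t + twistCount σ ω₂ ζ₂ n a t = 2 ∧ ¬(a = 0 ∧ t = 0)) ∨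
      twistCount σ ω₁ ζ₁ n a t + twistCount σ ω₂ ζ₂ n a t = 2 * q ^ 2 := by
  obtain ⟨h1, h2, h3⟩ | ⟨h1, h3⟩ | ⟨h1, h2, h3⟩ := h.twistCount_cases hT₁ hn hσn ht (a := a) <;>
  obtain ⟨h4, h5, h6⟩ | ⟨h4, h6⟩ | ⟨h4, h5, h6⟩ := h.twistCount_cases hT₂ hn hσn ht (a := a)
  · right; omega
  · exact absurd ⟨h1, h2⟩ h4
  · exact absurd h1 h4
  · exact absurd ⟨h4, h5⟩ h1
  · left; exact ⟨by omega, h1⟩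
  · right; omega
  · exact absurd h4 h1
  · right; omega
  · refine absurd ?_ hne
    have h7 : 4 * (a * σ a) ≠ 0 := by
      rw [show (4 : F) = 2 * 2 by norm_num]
      simp [h.two_ne, h1]
    exact mul_left_cancel₀ h7 (by linear_combination h2 - h5)

open Finset in
theorem sum_weight_mul_planeSum (h : IsConjSetting q σ e) {ω₁ ζ₁ ω₂ ζ₂ : F}
    (hζ₁ : σ ζ₁ = ζ₁) (hζ₂ : σ ζ₂ = ζ₂)
    (hW : ∀ b κ : F, b ≠ 0 → b * σ b = κ ^ 2 → σ κ = κ →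
      binGauss σ e (-b * (2 * ω₁)) (-(κ * (2 * ζ₁))) +
        binGauss σ e (-b * (2 * ω₂)) (-(κ * (2 * ζ₂))) = 0) (P P' R R' : F) :
    ∃ n, n ≠ 0 ∧ σ n = n ∧
      ∑ b, ∑ c, (binGauss σ e (-b * (2 * ω₁)) (-((c + σ c) * (2 * ζ₁))) +
        binGauss σ e (-b * (2 * ω₂)) (-((c + σ c) * (2 * ζ₂)))) *
          planeSum σ e P P' R R' b (c + σ c) =
      2 * (q : ℂ) ^ 3 * (planeSum σ e P P' R R' 0 0 - q ^ 2) + (q : ℂ) ^ 4 *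
        (twistCount σ ω₁ ζ₁ n (P * R + P' * R')
            (P * σ R' + P' * σ R + σ (P * σ R' + P' * σ R)) +
          twistCount σ ω₂ ζ₂ n (P * R + P' * R')
            (P * σ R' + P' * σ R + σ (P * σ R' + P' * σ R)) : ℕ) := by
  classical
  set t := P * σ R' + P' * σ R + σ (P * σ R' + P' * σ R) with ht
  have hσt : σ t = t := by rw [ht, map_add, h.invol, add_comm]
  obtain ⟨n, hn, hσn, hsc⟩ := h.exists_scale (P * R + P' * R') hσt
  refine ⟨n, hn, hσn, ?_⟩
  have key : ∀ b c : F, (binGauss σ e (-b * (2 * ω₁)) (-((c + σ c) * (2 * ζ₁))) +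
        binGauss σ e (-b * (2 * ω₂)) (-((c + σ c) * (2 * ζ₂)))) *
          planeSum σ e P P' R R' b (c + σ c) =
      (if b = 0 then if c + σ c = 0 then
        2 * (q : ℂ) ^ 2 * (planeSum σ e P P' R R' 0 0 - q ^ 2) else 0 else 0) +
      (binGauss σ e (-b * (2 * ω₁)) (-((c + σ c) * (2 * ζ₁))) *
        binGauss σ e (n * (-σ b * (P * R + P' * R'))) (n * ((c + σ c) * t / 2)) +
      binGauss σ e (-b * (2 * ω₂)) (-((c + σ c) * (2 * ζ₂))) *
        binGauss σ e (n * (-σ b * (P * R + P' * R'))) (n * ((c + σ c) * t / 2))) := by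
    intro b c
    have hκ : σ (c + σ c) = c + σ c := by rw [map_add, h.invol, add_comm]
    generalize c + σ c = κ at hκ
    by_cases hD : b * σ b - κ ^ 2 = 0
    · by_cases hb : b = 0
      · subst hb
        have : κ = 0 := by simpa using hD
        subst this
        simp only [if_true, neg_zero, zero_mul, mul_zero, map_zero, zero_div, h.binGauss_zero]
        ring
      · rw [if_neg hb, ← add_mul, hW b κ hb (sub_eq_zero.1 hD) hκ]
        ring
    · rw [h.planeSum_eq P P' R R' hκ hD, ← ht, hsc b κ hκ hD, ← add_mul]
      have : ¬(b = 0 ∧ κ = 0) := by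
        rintro ⟨rfl, rfl⟩
        simp at hD
      rw [← ite_and, if_neg this, zero_add]
  simp only [key, sum_add_distrib, h.sum_binGauss_mul _ _ hζ₁ hσn hσt,
    h.sum_binGauss_mul _ _ hζ₂ hσn hσt]
  rw [sum_eq_single_of_mem 0 (mem_univ _) fun b _ hb => sum_eq_zero fun c _ => if_neg hb]
  simp only [if_true]
  rw [← sum_filter, sum_const, h.card_filter_neg]
  push_cast
  rw [nsmul_eq_mul]
  ring

theorem Hf_eq (h : IsConjSetting q σ e) (v : Fin 4 → F) :
    Hf q v = v 0 * σ (v 0) - v 1 * σ (v 1) - v 2 * σ (v 2) + v 3 * σ (v 3) := by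
  simp only [Hf, h.mul_conj]

theorem conj_Hf (h : IsConjSetting q σ e) (v : Fin 4 → F) : σ (Hf q v) = Hf q v := by
  rw [h.Hf_eq]
  simp only [map_add, map_sub, map_mul, h.invol]
  ring

theorem two_mul_Hf_hypCoord (h : IsConjSetting q σ e) (u : (F × F) × (F × F)) :
    2 * Hf q (hypCoord h.two_ne u) =
      (u.1.1 * σ u.2.2 + u.1.2 * σ u.2.1) + σ (u.1.1 * σ u.2.2 + u.1.2 * σ u.2.1) := by
  have h2 := h.two_ne
  rw [h.Hf_eq]
  simp only [hypCoord, Equiv.coe_fn_mk, Matrix.cons_val, map_add, map_sub, map_mul, map_div₀,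
    map_ofNat, h.invol]
  field_simp
  ring

open Finset Classical in
theorem card_add_card (h : IsConjSetting q σ e) {ξ₁ ω₁ ζ₁ ξ₂ ω₂ ζ₂ : F}
    (hT₁ : IsTwist q σ ξ₁ ω₁ ζ₁) (hT₂ : IsTwist q σ ξ₂ ω₂ ζ₂) (hne : ξ₁ ≠ ξ₂)
    (π : (Fin 4 → F) →ₗ[F] F) {P P' R R' : F}
    (hπ : ∀ u : (F × F) × (F × F),
        π (hypCoord h.two_ne u) = u.1.1 * R + u.2.1 * P + u.1.2 * R' + u.2.2 * P') :
    #{w : ((F × F) × (F × F)) × F |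
      w.1.1.1 * w.1.2.1 + w.1.1.2 * w.1.2.2 = 2 * ω₁ * w.2 ^ 2 ∧
      (w.1.1.1 * σ w.1.2.2 + w.1.1.2 * σ w.1.2.1) + σ (w.1.1.1 * σ w.1.2.2 + w.1.1.2 * σ w.1.2.1) =
        2 * (2 * ζ₁) * (w.2 * σ w.2) ∧
      w.1.1.1 * R + w.1.2.1 * P + w.1.1.2 * R' + w.1.2.2 * P' = 0} +
    #{w : ((F × F) × (F × F)) × F |
      w.1.1.1 * w.1.2.1 + w.1.1.2 * w.1.2.2 = 2 * ω₂ * w.2 ^ 2 ∧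
      (w.1.1.1 * σ w.1.2.2 + w.1.1.2 * σ w.1.2.1) + σ (w.1.1.1 * σ w.1.2.2 + w.1.1.2 * σ w.1.2.1) =
        2 * (2 * ζ₂) * (w.2 * σ w.2) ∧
      w.1.1.1 * R + w.1.2.1 * P + w.1.1.2 * R' + w.1.2.2 * P' = 0} =
    2 * #{v : Fin 4 → F | (Hf q v = 2 * ξ₁ * Qf v ^ ((q + 1) / 2) ∨
      Hf q v = 2 * ξ₂ * Qf v ^ ((q + 1) / 2)) ∧ π v = 0} := by
  have hg : ∀ (ω ζ : F) (u : (F × F) × (F × F)) (g : F),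
      (u.1.1 * u.2.1 + u.1.2 * u.2.2 = 2 * ω * g ^ 2 ∧
      (u.1.1 * σ u.2.2 + u.1.2 * σ u.2.1) + σ (u.1.1 * σ u.2.2 + u.1.2 * σ u.2.1) =
        2 * (2 * ζ) * (g * σ g) ∧
      u.1.1 * R + u.2.1 * P + u.1.2 * R' + u.2.2 * P' = 0) ↔
      π (hypCoord h.two_ne u) = 0 ∧ Qf (hypCoord h.two_ne u) = ω * g ^ 2 ∧
        Hf q (hypCoord h.two_ne u) = 2 * ζ * (g * σ g) := fun ω ζ u g => by
    rw [← two_mul_Qf_hypCoord h.two_ne, ← h.two_mul_Hf_hypCoord, ← hπ, mul_assoc,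
      mul_assoc 2 (2 * ζ), mul_right_inj' h.two_ne, mul_right_inj' h.two_ne]
    tauto
  simp only [hg]
  rw [Finset.card_filter, Finset.card_filter, Fintype.sum_prod_type (α₁ := (F × F) × (F × F)),
    Fintype.sum_prod_type (α₁ := (F × F) × (F × F)), ← sum_add_distrib, Finset.card_filter,
    ← Equiv.sum_comp (hypCoord h.two_ne), mul_sum]
  refine sum_congr rfl fun u _ => ?_
  by_cases h0 : π (hypCoord h.two_ne u) = 0
  · simp only [h0, true_and, and_true]
    rw [← Finset.card_filter, ← Finset.card_filter]
    exact h.card_twist_add hT₁ hT₂ hne (h.conj_Hf _)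
  · simp [h0]

open Finset Classical in
theorem card_cone (h : IsConjSetting q σ e) {ξ₁ ξ₂ : F} (hξ₁ : ξ₁ ∈ Zone q F)
    (hξ₂ : ξ₂ ∈ Ztwo q F) (π : (Fin 4 → F) →ₗ[F] F) :
    (π = 0 → #{v : Fin 4 → F | (Hf q v = 2 * ξ₁ * Qf v ^ ((q + 1) / 2) ∨
      Hf q v = 2 * ξ₂ * Qf v ^ ((q + 1) / 2)) ∧ π v = 0} + q ^ 3 = q ^ 7 + q ^ 4) ∧
    (π ≠ 0 → #{v : Fin 4 → F | (Hf q v = 2 * ξ₁ * Qf v ^ ((q + 1) / 2) ∨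
      Hf q v = 2 * ξ₂ * Qf v ^ ((q + 1) / 2)) ∧ π v = 0} + q ^ 3 = q ^ 5 + q ^ 2 ∨
      #{v : Fin 4 → F | (Hf q v = 2 * ξ₁ * Qf v ^ ((q + 1) / 2) ∨
      Hf q v = 2 * ξ₂ * Qf v ^ ((q + 1) / 2)) ∧ π v = 0} + q ^ 3 = q ^ 5 + q ^ 4) := by
  obtain ⟨h10, -, -, d₁, hσ₁, hd₁0, hd₁⟩ := hξ₁
  obtain ⟨h20, hfix, hne0, hnsq⟩ := hξ₂
  rw [← h.map_eq] at hσ₁ hfix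
  obtain ⟨d₂, hd₂⟩ := h.isSquare_of_fixed hfix
  rw [← pow_two] at hd₂
  have hd₂0 : d₂ ≠ 0 := by
    rintro rfl
    exact hne0 (by rw [hd₂]; ring)
  have hσ₂ : σ d₂ = -d₂ := by
    rw [hd₂, map_pow, sq_eq_sq_iff_eq_or_eq_neg] at hfix
    exact hfix.resolve_left fun h3 => hnsq ⟨d₂, by rw [← h.map_eq, h3], hd₂⟩
  have hsq : ∀ ξ d : F, 1 - (ξ ^ 2)⁻¹ = d ^ 2 → σ (d ^ 2) = d ^ 2 → σ (ξ ^ 2) = ξ ^ 2 := by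
    intro ξ d hd hσ
    rw [← hd, map_sub, map_one, map_inv₀, sub_right_inj] at hσ
    exact inv_injective hσ
  obtain ⟨ω₁, ζ₁, hT₁⟩ := h.exists_isTwist h10 (hsq ξ₁ d₁ hd₁ (by rw [map_pow, hσ₁]))
  obtain ⟨ω₂, ζ₂, hT₂⟩ := h.exists_isTwist h20 (hsq ξ₂ d₂ hd₂ (by rw [map_pow, hσ₂, neg_sq]))
  have hne2 : ξ₁ ^ 2 ≠ ξ₂ ^ 2 := fun h0 => hnsq ⟨d₁, by rw [← h.map_eq, hσ₁], by rw [← h0, hd₁]⟩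
  have hne : ξ₁ ≠ ξ₂ := fun h0 => hne2 (by rw [h0])
  obtain ⟨P, P', R, R', hπ0, hπ⟩ := exists_functional_coeff h.two_ne π
  have hc := h.card_add_card hT₁ hT₂ hne π hπ
  set N := #{v : Fin 4 → F | (Hf q v = 2 * ξ₁ * Qf v ^ ((q + 1) / 2) ∨
      Hf q v = 2 * ξ₂ * Qf v ^ ((q + 1) / 2)) ∧ π v = 0}
  have hE₁ := h.count_eq P P' R R' (2 * ω₁) (ζ := 2 * ζ₁)
    (by rw [map_mul, map_ofNat, hT₁.conj_zeta])
  have hE₂ := h.count_eq P P' R R' (2 * ω₂) (ζ := 2 * ζ₂)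
    (by rw [map_mul, map_ofNat, hT₂.conj_zeta])
  obtain ⟨n, hn, hσn, hsum⟩ := h.sum_weight_mul_planeSum hT₁.conj_zeta hT₂.conj_zeta
    (fun b κ hb0 hb hκ =>
      h.binGauss_add_eq_zero hT₁ h10 hd₁ hd₁0 hσ₁ hT₂ h20 hd₂ hd₂0 hσ₂ hb0 hb hκ)
    P P' R R'
  have hσt : σ (P * σ R' + P' * σ R + σ (P * σ R' + P' * σ R)) =
      P * σ R' + P' * σ R + σ (P * σ R' + P' * σ R) := by rw [map_add, h.invol, add_comm]
  simp only [add_mul (binGauss σ e _ _), sum_add_distrib] at hsum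
  have hq : (q : ℂ) ≠ 0 := by
    have := h.one_lt
    exact_mod_cast (by omega)
  have hc' := congrArg (Nat.cast : ℕ → ℂ) hc
  rw [Nat.cast_add, Nat.cast_mul, Nat.cast_ofNat] at hc'
  have main : 2 * (q : ℂ) ^ 2 * N = 2 * (q : ℂ) ^ 3 * (planeSum σ e P P' R R' 0 0 - q ^ 2) +
      (q : ℂ) ^ 4 * (twistCount σ ω₁ ζ₁ n (P * R + P' * R')
            (P * σ R' + P' * σ R + σ (P * σ R' + P' * σ R)) +
          twistCount σ ω₂ ζ₂ n (P * R + P' * R')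
            (P * σ R' + P' * σ R + σ (P * σ R' + P' * σ R)) : ℕ) := by
    rw [← hsum]
    refine mul_left_cancel₀ (pow_ne_zero 4 hq) ?_
    linear_combination hE₁ + hE₂ - (q : ℂ) ^ 6 * hc'
  have hcnt := h.twistCount_add hT₁ hT₂ hne2 hn hσn hσt (a := P * R + P' * R')
  have fin : ∀ A B : ℕ, (2 * (q : ℂ) ^ 2 * N + 2 * q ^ 2 * A = 2 * q ^ 2 * B) → N + A = B := by
    intro A B hAB
    have : 2 * (q : ℂ) ^ 2 ≠ 0 := mul_ne_zero two_ne_zero (pow_ne_zero 2 hq)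
    rw [← mul_add] at hAB
    exact_mod_cast mul_left_cancel₀ this hAB
  constructor
  · intro h0
    obtain ⟨rfl, rfl, rfl, rfl⟩ := hπ0.1 h0
    replace hcnt := hcnt.resolve_left fun h1 => h1.2 (by simp)
    rw [hcnt, h.planeSum_zero_zero] at main
    refine fin _ _ ?_
    rw [main]
    push_cast
    ring
  · intro h0
    rw [h.planeSum_zero (mt hπ0.2 h0)] at main
    obtain ⟨h1, -⟩ | h1 := hcnt
    · rw [h1] at main
      refine Or.inl (fin _ _ ?_)
      rw [main]
      push_cast
      ring
    · rw [h1] at main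
      refine Or.inr (fin _ _ ?_)
      rw [main]
      push_cast
      ring

end IsConjSetting

theorem Fline_smul {F : Type*} [Field F] {a : F} (ha : a ≠ 0) (v : Fin 4 → F) :
    Fline (a • v) = Fline v := by
  ext x
  constructor
  · rintro ⟨b, rfl⟩
    exact ⟨b * a, by rw [mul_smul]⟩
  · rintro ⟨b, rfl⟩
    exact ⟨b / a, by rw [smul_smul, div_mul_cancel₀ b ha]⟩

theorem self_mem_Fline {F : Type*} [Field F] (v : Fin 4 → F) : v ∈ Fline v :=
  ⟨1, by rw [one_smul]⟩

theorem Qf_smul {F : Type*} [Field F] (a : F) (v : Fin 4 → F) : Qf (a • v) = a ^ 2 * Qf v := by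
  simp only [Qf, Pi.smul_apply, smul_eq_mul]
  ring

theorem Hf_smul (q : ℕ) {F : Type*} [Field F] (a : F) (v : Fin 4 → F) :
    Hf q (a • v) = a ^ (q + 1) * Hf q v := by
  simp only [Hf, Pi.smul_apply, smul_eq_mul, mul_pow]
  ring

theorem cone_smul {q : ℕ} (hq : Odd q) {F : Type*} [Field F] {ξ : F} (a : F) {v : Fin 4 → F}
    (hv : Hf q v = 2 * ξ * Qf v ^ ((q + 1) / 2)) :
    Hf q (a • v) = 2 * ξ * Qf (a • v) ^ ((q + 1) / 2) := by
  have h2 : 2 * ((q + 1) / 2) = q + 1 := by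
    obtain ⟨k, rfl⟩ := hq
    omega
  rw [Hf_smul, Qf_smul, mul_pow, ← pow_mul, h2, hv]
  ring

open Finset Classical in
/-- Each point of the join lying in `π = 0` accounts for `q ^ 2 - 1` nonzero vectors of the cone. -/
theorem ncard_mul_add_one {q : ℕ} (hq : Odd q) {F : Type*} [Field F] [Fintype F]
    (hF : Fintype.card F = q ^ 2) (ξ₁ ξ₂ : F) (π : (Fin 4 → F) →ₗ[F] F) :
    Set.ncard {L | L ∈ joinSet q ξ₁ ξ₂ ∧ ∀ x ∈ L, π x = 0} * (q ^ 2 - 1) + 1 =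
      #{v : Fin 4 → F | (Hf q v = 2 * ξ₁ * Qf v ^ ((q + 1) / 2) ∨
        Hf q v = 2 * ξ₂ * Qf v ^ ((q + 1) / 2)) ∧ π v = 0} := by
  set S : Finset (Fin 4 → F) := {v : Fin 4 → F | (Hf q v = 2 * ξ₁ * Qf v ^ ((q + 1) / 2) ∨
        Hf q v = 2 * ξ₂ * Qf v ^ ((q + 1) / 2)) ∧ π v = 0} with hS
  have hm : (q + 1) / 2 ≠ 0 := by
    obtain ⟨k, rfl⟩ := hq
    omega
  have h0 : (0 : Fin 4 → F) ∈ S := by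
    simp only [hS, mem_filter, mem_univ, true_and]
    simp [Hf, Qf, hm]
  have hsmul : ∀ (a : F) (v : Fin 4 → F), v ∈ S → a • v ∈ S := fun a v hv => by
    simp only [hS, mem_filter, mem_univ, true_and] at hv ⊢
    exact ⟨hv.1.imp (cone_smul hq a) (cone_smul hq a), by rw [map_smul, hv.2, smul_zero]⟩
  have hL : {L | L ∈ joinSet q ξ₁ ξ₂ ∧ ∀ x ∈ L, π x = 0} = ((S.erase 0).image Fline : Finset _) := by
    ext L
    simp only [joinSet, Set.mem_ofPred_eq, coe_image, Set.mem_image, mem_coe, mem_erase, hS,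
      mem_filter, mem_univ, true_and]
    constructor
    · rintro ⟨⟨v, hv, hc, rfl⟩, hπ⟩
      exact ⟨v, ⟨hv, hc, hπ v (self_mem_Fline v)⟩, rfl⟩
    · rintro ⟨v, ⟨hv, hc, hπ⟩, rfl⟩
      refine ⟨⟨v, hv, hc, rfl⟩, ?_⟩
      rintro x ⟨a, rfl⟩
      rw [map_smul, hπ, smul_zero]
  rw [hL, Set.ncard_coe_finset, ← card_erase_add_one h0, card_eq_sum_card_image Fline (S.erase 0),
    sum_const_nat]
  intro L hL
  obtain ⟨v, hv, rfl⟩ := mem_image.1 hL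
  obtain ⟨hv0, hvS⟩ := mem_erase.1 hv
  have hfib : ({w ∈ S.erase 0 | Fline w = Fline v} : Finset _) =
      (univ.erase (0 : F)).image fun a => a • v := by
    ext w
    simp only [mem_filter, mem_erase, mem_image, mem_univ, and_true]
    constructor
    · rintro ⟨⟨hw0, -⟩, hw⟩
      obtain ⟨a, rfl⟩ : w ∈ Fline v := hw ▸ self_mem_Fline w
      exact ⟨a, fun ha => hw0 (by rw [ha, zero_smul]), rfl⟩
    · rintro ⟨a, ha, rfl⟩
      exact ⟨⟨smul_ne_zero ha hv0, hsmul a v hvS⟩, Fline_smul ha v⟩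
  rw [hfib, card_image_of_injective _ (smul_left_injective F hv0), card_erase_of_mem (mem_univ _),
    card_univ, hF]

/-- The join `S_{ξ₁} ∪ S_{ξ₂}`, `ξ₁ ∈ Z₁`, `ξ₂ ∈ Z₂`, is a quasi-Hermitian surface of
`PG(3,q²)`: it has `(q²+1)(q³+1)` points and every plane meets it in `q³+1` or
`q³+q²+1` points. -/
theorem stmt18 (q : ℕ) (hq : ∃ p k : ℕ, p.Prime ∧ 0 < k ∧ q = p ^ k) (hodd : Odd q)
    (F : Type*) [Field F] [Fintype F] (hF : Fintype.card F = q ^ 2)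
    (ξ₁ ξ₂ : F) (hξ₁ : ξ₁ ∈ Zone q F) (hξ₂ : ξ₂ ∈ Ztwo q F) :
    (joinSet q ξ₁ ξ₂).ncard = (q ^ 2 + 1) * (q ^ 3 + 1) ∧
    ∀ π : (Fin 4 → F) →ₗ[F] F, π ≠ 0 →
      (Set.ncard {L | L ∈ joinSet q ξ₁ ξ₂ ∧ ∀ x ∈ L, π x = 0} = q ^ 3 + 1 ∨
        Set.ncard {L | L ∈ joinSet q ξ₁ ξ₂ ∧ ∀ x ∈ L, π x = 0} = q ^ 3 + q ^ 2 + 1) := by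
  obtain ⟨σ, e, h⟩ := exists_isConjSetting hq hodd hF
  have hq1 := h.one_lt
  have solve : ∀ n m N : ℕ, n * (q ^ 2 - 1) + 1 = N → N = m * (q ^ 2 - 1) + 1 → n = m := by
    intro n m N h1 h2
    have : 0 < q ^ 2 - 1 := Nat.sub_pos_of_lt (Nat.one_lt_pow two_ne_zero hq1)
    rw [h2] at h1
    exact Nat.eq_of_mul_eq_mul_right this (Nat.add_right_cancel h1)
  obtain ⟨k, hk⟩ : ∃ k, q ^ 2 = k + 1 := ⟨q ^ 2 - 1, by have := pow_pos (by omega : 0 < q) 2; omega⟩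
  have hk' : q ^ 2 - 1 = k := by omega
  rw [hk'] at solve
  constructor
  · have h1 := ncard_mul_add_one hodd hF ξ₁ ξ₂ 0
    rw [hk'] at h1
    simp only [LinearMap.zero_apply, implies_true, and_true, Set.ofPred_mem_eq] at h1
    have h2 := (h.card_cone hξ₁ hξ₂ 0).1 rfl
    simp only [LinearMap.zero_apply, and_true] at h2
    refine solve _ _ _ h1 ?_
    refine Nat.add_right_cancel (m := q ^ 3) (h2.trans ?_)
    zify at hk ⊢
    linear_combination (q ^ 5 + q ^ 3 + q ^ 2 + 1 : ℤ) * hk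
  · intro π hπ
    have h1 := ncard_mul_add_one hodd hF ξ₁ ξ₂ π
    rw [hk'] at h1
    refine ((h.card_cone hξ₁ hξ₂ π).2 hπ).imp (fun h2 => ?_) fun h2 => ?_ <;>
      refine solve _ _ _ h1 (Nat.add_right_cancel (m := q ^ 3) (h2.trans ?_)) <;>
      zify at hk ⊢
    · linear_combination (q ^ 3 + 1 : ℤ) * hk
    · linear_combination (q ^ 3 + q ^ 2 + 1 : ℤ) * hk
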